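/- Fix (p,q) ∈ ℤ² and suppose that H_{d'}^{p,q} is a finite-dimensional ℂ-vector space. Then the quotients S := (ker d' ∩ Im d'' ∩ A^{p,q})/(Im d' ∩ Im d'' ∩ A^{p,q}) and T := ((ker d' + Im d'') ∩ A^{p,q})/((Im d' + Im d'') ∩ A^{p,q}) are finite dimensional and dim_ℂ H_{d'}^{p,q} = dim_ℂ S + dim_ℂ T. -/

import Mathlib

open Submodule

/-- A double complex of complex vector spaces, realized as an internally bigraded
module `W = ⊕_{p,q} A p q` together with global differentials `d'`, `d''` of
bidegrees `(1,0)` and `(0,1)` satisfying `d'∘d' = 0`, `d''∘d'' = 0` and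
`d'∘d'' + d''∘d' = 0`. -/
structure BiComplex (W : Type*) [AddCommGroup W] [Module ℂ W] where
  A : ℤ → ℤ → Submodule ℂ W
  d' : W →ₗ[ℂ] W
  d'' : W →ₗ[ℂ] W
  internal : DirectSum.IsInternal (fun pq : ℤ × ℤ => A pq.1 pq.2)
  map_d' : ∀ p q : ℤ, (A p q).map d' ≤ A (p + 1) q
  map_d'' : ∀ p q : ℤ, (A p q).map d'' ≤ A p (q + 1)
  d'_sq : d' ∘ₗ d' = 0
  d''_sq : d'' ∘ₗ d'' = 0
  anticomm : d' ∘ₗ d'' + d'' ∘ₗ d' = 0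

namespace BiComplex

variable {W : Type*} [AddCommGroup W] [Module ℂ W] (C : BiComplex W)

/-- `ker d' ∩ A^{p,q}` : the kernel of `d' : A^{p,q} → A^{p+1,q}`. -/
def kerd' (p q : ℤ) : Submodule ℂ W := LinearMap.ker C.d' ⊓ C.A p q

/-- `ker d'' ∩ A^{p,q}` : the kernel of `d'' : A^{p,q} → A^{p,q+1}`. -/
def kerd'' (p q : ℤ) : Submodule ℂ W := LinearMap.ker C.d'' ⊓ C.A p q

/-- `Im d' ∩ A^{p,q} = d'(A^{p-1,q})`. -/
def imd' (p q : ℤ) : Submodule ℂ W := (C.A (p - 1) q).map C.d'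

/-- `Im d'' ∩ A^{p,q} = d''(A^{p,q-1})`. -/
def imd'' (p q : ℤ) : Submodule ℂ W := (C.A p (q - 1)).map C.d''

/-- `Im d'd'' ∩ A^{p,q} = (d'∘d'')(A^{p-1,q-1})`. -/
def imd'd'' (p q : ℤ) : Submodule ℂ W := (C.A (p - 1) (q - 1)).map (C.d' ∘ₗ C.d'')

/-- `ker d'd'' ∩ A^{p,q}` : the kernel of `d'∘d'' : A^{p,q} → A^{p+1,q+1}`. -/
def kerd'd'' (p q : ℤ) : Submodule ℂ W := LinearMap.ker (C.d' ∘ₗ C.d'') ⊓ C.A p q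

/-- The `d'd''`-lemma at `(p,q)`:
`Im d' ∩ ker d'' ∩ A^{p,q} = ker d' ∩ Im d'' ∩ A^{p,q} = Im d'd'' ∩ A^{p,q}`. -/
def DDLemmaAt (p q : ℤ) : Prop :=
  C.imd' p q ⊓ C.kerd'' p q = C.imd'd'' p q ∧ C.kerd' p q ⊓ C.imd'' p q = C.imd'd'' p q

/-- The total-degree piece `A^k = ⊕_{p+q=k} A^{p,q}`. -/
def Atot (k : ℤ) : Submodule ℂ W := ⨆ p : ℤ, C.A p (k - p)

/-- The total differential `d = d' + d''`. -/
def dtot : W →ₗ[ℂ] W := C.d' + C.d''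

/-- `ker d ∩ A^k` : the kernel of `d : A^k → A^{k+1}`. -/
def kerdTot (k : ℤ) : Submodule ℂ W := LinearMap.ker C.dtot ⊓ C.Atot k

/-- `Im d ∩ A^k = d(A^{k-1})`. -/
def imdTot (k : ℤ) : Submodule ℂ W := (C.Atot (k - 1)).map C.dtot

/-- `ker d' ∩ ker d'' ∩ A^k = ⊕_{p+q=k} (ker d' ∩ ker d'' ∩ A^{p,q})`. -/
def kerd'kerd''Tot (k : ℤ) : Submodule ℂ W :=
  ⨆ p : ℤ, (C.kerd' p (k - p) ⊓ C.kerd'' p (k - p))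

/-- `Im d'd'' ∩ A^k = ⊕_{p+q=k} (Im d'd'' ∩ A^{p,q})`. -/
def imd'd''Tot (k : ℤ) : Submodule ℂ W := ⨆ p : ℤ, C.imd'd'' p (k - p)

/-- `ker d'd'' ∩ A^k = ⊕_{p+q=k} (ker d'd'' ∩ A^{p,q})`. -/
def kerd'd''Tot (k : ℤ) : Submodule ℂ W := ⨆ p : ℤ, C.kerd'd'' p (k - p)

/-- `Im d' ∩ A^k = ⊕_{p+q=k} (Im d' ∩ A^{p,q})`. -/
def imd'Tot (k : ℤ) : Submodule ℂ W := ⨆ p : ℤ, C.imd' p (k - p)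

/-- `Im d'' ∩ A^k = ⊕_{p+q=k} (Im d'' ∩ A^{p,q})`. -/
def imd''Tot (k : ℤ) : Submodule ℂ W := ⨆ p : ℤ, C.imd'' p (k - p)

/-- The double complex is totally bounded: `A^{p,q} = 0` for `|p| > N` or `|q| > N`. -/
def TotallyBounded : Prop :=
  ∃ N : ℕ, ∀ p q : ℤ, ((N : ℤ) < |p| ∨ (N : ℤ) < |q|) → C.A p q = ⊥

end BiComplex

/-- The quotient vector space `S / T` of a submodule `S` by (the trace of) a
submodule `T ≤ S`. -/
abbrev quotSub {W : Type*} [AddCommGroup W] [Module ℂ W] (S T : Submodule ℂ W) :=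
  S ⧸ (Submodule.comap S.subtype T)

/-- For `I ≤ K`, passing to intersections and sums with `B` splits the dimension of `K / I`. -/
theorem finrank_quotSub_eq_inf_add_sup {W : Type*} [AddCommGroup W] [Module ℂ W]
    {K I : Submodule ℂ W} (B : Submodule ℂ W) (hIK : I ≤ K)
    [FiniteDimensional ℂ (quotSub K I)] :
    FiniteDimensional ℂ (quotSub (K ⊓ B) (I ⊓ B)) ∧
    FiniteDimensional ℂ (quotSub (K ⊔ B) (I ⊔ B)) ∧
    Module.finrank ℂ (quotSub K I) =
      Module.finrank ℂ (quotSub (K ⊓ B) (I ⊓ B)) +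
        Module.finrank ℂ (quotSub (K ⊔ B) (I ⊔ B)) := by
  let f : quotSub (K ⊓ B) (I ⊓ B) →ₗ[ℂ] quotSub K I :=
    Submodule.mapQ _ _ (Submodule.inclusion inf_le_left) fun _ hx => hx.1
  let g : quotSub K I →ₗ[ℂ] quotSub (K ⊔ B) (I ⊔ B) :=
    Submodule.mapQ _ _ (Submodule.inclusion le_sup_left)
      fun _ hx => Submodule.mem_sup_left (S := I) hx
  have hf : Function.Injective f := by
    rw [← LinearMap.ker_eq_bot, LinearMap.ker_eq_bot']
    intro x hx
    obtain ⟨x, rfl⟩ := Submodule.Quotient.mk_surjective _ x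
    have hmem := (Submodule.Quotient.mk_eq_zero (I.comap K.subtype)).1 hx
    exact (Submodule.Quotient.mk_eq_zero _).2 ⟨hmem, x.2.2⟩
  have hg : Function.Surjective g := by
    intro y
    obtain ⟨⟨y, hy⟩, rfl⟩ := Submodule.Quotient.mk_surjective _ y
    obtain ⟨k, hk, b, hb, rfl⟩ := Submodule.mem_sup.1 hy
    refine ⟨Submodule.Quotient.mk ⟨k, hk⟩, (Submodule.Quotient.eq _).2 ?_⟩
    change k - (k + b) ∈ I ⊔ B
    rw [sub_add_cancel_left]
    exact Submodule.mem_sup_right (neg_mem hb)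
  have hfg : LinearMap.ker g = LinearMap.range f := by
    ext x
    obtain ⟨⟨k, hk⟩, rfl⟩ := Submodule.Quotient.mk_surjective _ x
    constructor
    · intro hx
      have hmem : k ∈ I ⊔ B :=
        (Submodule.Quotient.mk_eq_zero ((I ⊔ B).comap (K ⊔ B).subtype)).1 hx
      obtain ⟨i, hi, b, hb, rfl⟩ := Submodule.mem_sup.1 hmem
      have hbK : b ∈ K := (Submodule.add_mem_iff_right K (hIK hi)).1 hk
      refine ⟨Submodule.Quotient.mk ⟨b, hbK, hb⟩, (Submodule.Quotient.eq _).2 ?_⟩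
      change b - (i + b) ∈ I
      rw [sub_add_cancel_right]
      exact neg_mem hi
    · rintro ⟨y, hy⟩
      obtain ⟨⟨b, hbK, hb⟩, rfl⟩ := Submodule.Quotient.mk_surjective _ y
      rw [← hy]
      exact (Submodule.Quotient.mk_eq_zero _).2 (Submodule.mem_sup_right (T := B) hb)
  refine ⟨FiniteDimensional.of_injective f hf, Module.Finite.of_surjective g hg, ?_⟩
  rw [← g.finrank_range_add_finrank_ker, LinearMap.range_eq_top.2 hg, finrank_top, hfg,
    LinearMap.finrank_range_of_inj hf, add_comm]

theorem BiComplex.imd'_le_kerd' {W : Type*} [AddCommGroup W] [Module ℂ W]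
    (C : BiComplex W) (p q : ℤ) : C.imd' p q ≤ C.kerd' p q := by
  refine le_inf ?_ (by simpa [imd'] using C.map_d' (p - 1) q)
  rintro _ ⟨x, -, rfl⟩
  exact LinearMap.congr_fun C.d'_sq x

/-- If `H_{d'}^{p,q} = (ker d' ∩ A^{p,q})/(Im d' ∩ A^{p,q})` is
finite dimensional, then the quotients
`S = (ker d' ∩ Im d'' ∩ A^{p,q})/(Im d' ∩ Im d'' ∩ A^{p,q})` and
`T = ((ker d' + Im d'') ∩ A^{p,q})/((Im d' + Im d'') ∩ A^{p,q})` are finite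
dimensional and `dim H_{d'}^{p,q} = dim S + dim T`. -/
theorem bicomplex_dim_Hd'_eq_s_plus_v
    {W : Type*} [AddCommGroup W] [Module ℂ W] (C : BiComplex W) (p q : ℤ)
    (hfin : FiniteDimensional ℂ (quotSub (C.kerd' p q) (C.imd' p q))) :
    FiniteDimensional ℂ
        (quotSub (C.kerd' p q ⊓ C.imd'' p q) (C.imd' p q ⊓ C.imd'' p q)) ∧
    FiniteDimensional ℂ
        (quotSub (C.kerd' p q ⊔ C.imd'' p q) (C.imd' p q ⊔ C.imd'' p q)) ∧
    Module.finrank ℂ (quotSub (C.kerd' p q) (C.imd' p q)) =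
      Module.finrank ℂ
          (quotSub (C.kerd' p q ⊓ C.imd'' p q) (C.imd' p q ⊓ C.imd'' p q)) +
        Module.finrank ℂ
          (quotSub (C.kerd' p q ⊔ C.imd'' p q) (C.imd' p q ⊔ C.imd'' p q)) := by
  exact finrank_quotSub_eq_inf_add_sup _ (C.imd'_le_kerd' p q)
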